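/- arXiv:0805.3767 — 3 statements merged into one kernel-verified Lean document; each statement's English description precedes it below -/
import Mathlib

section
/- For every δ with |δ| < 1/4, the Floquet Hamiltonian H has pure point spectrum: there exist an orthonormal Hilbert basis (φ_k)_{k∈ℕ} of ℓ²(ℤ×ℤ;ℂ) and real numbers (E_k)_{k∈ℕ} such that each φ_k satisfies (Hφ_k)(j,n) = E_k·φ_k(j,n) for all (j,n) ∈ ℤ×ℤ. -/
noncomputable section

/-- The Floquet Hamiltonian `H = diag (n + j²) + δ Δ̃` acting on functions on `ℤ × ℤ`. -/
def Hfl (δ : ℝ) (φ : ℤ × ℤ → ℂ) : ℤ × ℤ → ℂ := fun p =>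
  ((p.2 + p.1 ^ 2 : ℤ) : ℂ) * φ p +
    (δ : ℂ) * (φ (p.1 + 1, p.2 + 1) + φ (p.1 + 1, p.2 - 1) +
               φ (p.1 - 1, p.2 + 1) + φ (p.1 - 1, p.2 - 1))

section AbstractSpectral

open Module.End
open scoped Polynomial

variable {X : Type*} [NormedAddCommGroup X] [InnerProductSpace ℂ X]

theorem isCompactOperator_aeval_sub_aeval {R R₀ : X →L[ℂ] X}
    (h : IsCompactOperator (R - R₀)) (p : ℝ[X]) :
    IsCompactOperator (Polynomial.aeval R p - Polynomial.aeval R₀ p) := by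
  induction p using Polynomial.induction_on' with
  | add p q hp hq =>
    rw [map_add, map_add, add_sub_add_comm]
    exact hp.add hq
  | monomial n a =>
    simp only [Polynomial.aeval_monomial, ← Algebra.smul_def, ← smul_sub]
    refine IsCompactOperator.smul (f := ⇑(R ^ n - R₀ ^ n)) ?_ a
    induction n with
    | zero => simpa using isCompactOperator_zero
    | succ n ih =>
      have e : R ^ (n + 1) - R₀ ^ (n + 1) = R ^ n * (R - R₀) + (R ^ n - R₀ ^ n) * R₀ := by
        rw [pow_succ, pow_succ]; noncomm_ring
      rw [e]
      exact (h.clm_comp (R ^ n)).add (ih.comp_clm R₀)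

variable [CompleteSpace X]

theorem isCompactOperator_cfc_sub_cfc {R R₀ : X →L[ℂ] X} (hR : IsSelfAdjoint R)
    (hR₀ : IsSelfAdjoint R₀) (h : IsCompactOperator (R - R₀)) {g : ℝ → ℝ} (hg : Continuous g) :
    IsCompactOperator (cfc g R - cfc g R₀) := by
  obtain _ | _ := subsingleton_or_nontrivial X
  · rw [Subsingleton.elim (cfc g R - cfc g R₀) 0]
    exact isCompactOperator_zero
  refine isClosed_setOfPred_isCompactOperator.closure_subset
    (Metric.mem_closure_iff.2 fun ε hε => ?_)
  obtain ⟨p, hp⟩ := exists_polynomial_near_of_continuousOn (-(max ‖R‖ ‖R₀‖)) (max ‖R‖ ‖R₀‖) g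
    hg.continuousOn (ε / 3) (by positivity)
  refine ⟨_, isCompactOperator_aeval_sub_aeval h p, ?_⟩
  have key : ∀ A : X →L[ℂ] X, IsSelfAdjoint A → ‖A‖ ≤ max ‖R‖ ‖R₀‖ →
      ‖cfc g A - Polynomial.aeval A p‖ ≤ ε / 3 := by
    intro A hA hle
    rw [← cfc_polynomial p A, ← cfc_sub g p.eval A]
    refine norm_cfc_le (by positivity) fun x hx => ?_
    have hx' : |x| ≤ max ‖R‖ ‖R₀‖ := (spectrum.norm_le_norm_of_mem hx).trans hle
    rw [← norm_neg, neg_sub]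
    exact (hp x (abs_le.1 hx')).le
  have h1 := key R hR (le_max_left _ _)
  have h2 := key R₀ hR₀ (le_max_right _ _)
  rw [dist_eq_norm, sub_sub_sub_comm]
  refine (norm_sub_le _ _).trans_lt ?_
  linarith

theorem mem_orthogonal_iSup_eigenspace_of_commute {R T : X →L[ℂ] X} (hT : IsSelfAdjoint T)
    (hRT : Commute R T) {v : X}
    (hv : v ∈ (⨆ μ, eigenspace (R : Module.End ℂ X) μ)ᗮ) :
    T v ∈ (⨆ μ, eigenspace (R : Module.End ℂ X) μ)ᗮ := by
  rw [← Submodule.iInf_orthogonal, Submodule.mem_iInf] at hv ⊢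
  intro μ w hw
  have hTw : T w ∈ eigenspace (R : Module.End ℂ X) μ := by
    rw [mem_eigenspace_iff] at hw ⊢
    have := congrArg (fun A : X →L[ℂ] X => A w) hRT.eq
    simp only [mul_apply_eq_comp] at this
    change R (T w) = _
    rw [this, show R w = μ • w from hw, map_smul]
  have := hv μ (T w) hTw
  exact (hT.isSymmetric w v).symm.trans this

theorem eigenspace_le_iSup_eigenspace_of_commute {R T : X →L[ℂ] X} (hR : IsSelfAdjoint R)
    (hT : IsCompactOperator T) (hRT : Commute R T) {ν : ℂ} (hν : ν ≠ 0) :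
    eigenspace (T : Module.End ℂ X) ν ≤ ⨆ μ, eigenspace (R : Module.End ℂ X) μ := by
  have hfin := ContinuousLinearMap.finite_dimensional_eigenspace hT ν hν
  have hinv : ∀ w ∈ eigenspace (T : Module.End ℂ X) ν,
      (R : Module.End ℂ X) w ∈ eigenspace (T : Module.End ℂ X) ν := by
    intro w hw
    rw [mem_eigenspace_iff] at hw ⊢
    have := congrArg (fun A : X →L[ℂ] X => A w) hRT.eq
    simp only [mul_apply_eq_comp] at this
    change T (R w) = ν • R w
    rw [← this, show T w = ν • w from hw, map_smul]
  have hsymm := hR.isSymmetric.restrict_invariant hinv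
  have htop := Submodule.orthogonal_eq_bot_iff.1 hsymm.orthogonalComplement_iSup_eigenspaces_eq_bot
  intro w hw
  have hmem : (⟨w, hw⟩ : eigenspace (T : Module.End ℂ X) ν) ∈
      ⨆ μ, eigenspace ((R : Module.End ℂ X).restrict hinv) μ := htop ▸ Submodule.mem_top
  have hmap := Submodule.mem_map_of_mem (f := Submodule.subtype _) hmem
  rw [Submodule.map_iSup] at hmap
  refine (iSup_mono fun μ => ?_ : _ ≤ ⨆ μ, eigenspace (R : Module.End ℂ X) μ) hmap
  rintro _ ⟨u, hu, rfl⟩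
  have hu' := mem_eigenspace_iff.1 hu
  exact mem_eigenspace_iff.2 (congrArg Subtype.val hu')

theorem apply_eq_zero_of_mem_orthogonal_iSup_eigenspace {R T : X →L[ℂ] X} (hR : IsSelfAdjoint R)
    (hT : IsSelfAdjoint T) (hTc : IsCompactOperator T) (hRT : Commute R T) {v : X}
    (hv : v ∈ (⨆ μ, eigenspace (R : Module.End ℂ X) μ)ᗮ) : T v = 0 := by
  have hbot := ContinuousLinearMap.orthogonalComplement_iSup_eigenspaces_eq_bot hTc hT.isSymmetric
  rw [← Submodule.mem_bot ℂ, ← hbot, ← Submodule.iInf_orthogonal, Submodule.mem_iInf]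
  intro ν w hw
  refine (hT.isSymmetric w v).symm.trans ?_
  have hw' : T w = ν • w := mem_eigenspace_iff.1 hw
  change inner ℂ (T w) v = 0
  rw [hw']
  obtain rfl | hν := eq_or_ne ν 0
  · simp
  · rw [inner_smul_left,
      hv w (eigenspace_le_iSup_eigenspace_of_commute hR hTc hRT hν hw), mul_zero]

theorem cfc_apply_eq_zero_of_prod_sub {R : X →L[ℂ] X} (hR : IsSelfAdjoint R) (s : Finset ℝ)
    {g : ℝ → ℝ} (hg : Continuous g) {v : X}
    (hv : v ∈ (⨆ μ, eigenspace (R : Module.End ℂ X) μ)ᗮ)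
    (h : cfc (fun x => (∏ z ∈ s, (x - z)) * g x) R v = 0) : cfc g R v = 0 := by
  classical
  induction s using Finset.induction_on with
  | empty => simpa using h
  | insert z s hz ih =>
    refine ih ?_
    set w := cfc (fun x => (∏ z ∈ s, (x - z)) * g x) R v with hw
    have hcont : Continuous fun x => (∏ z ∈ s, (x - z)) * g x := by fun_prop
    have hwM : w ∈ (⨆ μ, eigenspace (R : Module.End ℂ X) μ)ᗮ :=
      mem_orthogonal_iSup_eigenspace_of_commute (cfc_predicate _ R)
        ((Commute.refl R).cfc_real _).symm hv
    have hmul : cfc (fun x => (∏ z ∈ insert z s, (x - z)) * g x) R =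
        (R - algebraMap ℝ (X →L[ℂ] X) z) * cfc (fun x => (∏ z ∈ s, (x - z)) * g x) R := by
      have e : cfc (fun x : ℝ => x - z) R = R - algebraMap ℝ (X →L[ℂ] X) z := by
        rw [cfc_sub (fun x => x) (fun _ => z) R, cfc_id' ℝ R, cfc_const z R]
      rw [← e, ← cfc_mul (fun x => x - z) _ R (by fun_prop) hcont.continuousOn]
      simp_rw [Finset.prod_insert hz, mul_assoc]
    rw [hmul, mul_apply_eq_comp, ← hw] at h
    have hwE : w ∈ eigenspace (R : Module.End ℂ X) (z : ℂ) := by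
      rw [mem_eigenspace_iff]
      change R w = _
      rw [sub_apply, sub_eq_zero] at h
      rw [h, Algebra.algebraMap_eq_smul_one]
      simp
    have hself := hwM w (Submodule.mem_iSup_of_mem _ hwE)
    exact inner_self_eq_zero.1 hself

/-- A self-adjoint compact perturbation of a self-adjoint operator whose spectrum accumulates
only at `0` has a total set of eigenvectors. -/
theorem orthogonal_iSup_eigenspace_eq_bot_of_isCompactOperator_sub {R R₀ : X →L[ℂ] X}
    (hR : IsSelfAdjoint R) (hR₀ : IsSelfAdjoint R₀) (h : IsCompactOperator (R - R₀))
    (hfin : ∀ ε > 0, {x ∈ spectrum ℝ R₀ | ε < |x|}.Finite) :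
    (⨆ μ, eigenspace (R : Module.End ℂ X) μ)ᗮ = ⊥ := by
  rw [Submodule.eq_bot_iff]
  intro v hv
  have hvanish : ∀ g : ℝ → ℝ, Continuous g → (∀ x ∈ spectrum ℝ R₀, g x = 0) →
      cfc g R v = 0 := by
    intro g hg h0
    have hc := isCompactOperator_cfc_sub_cfc hR hR₀ h hg
    have e : cfc g R₀ = 0 := by
      rw [cfc_congr (g := fun _ => 0) (fun x hx => h0 x hx)]
      simp
    rw [e, sub_zero] at hc
    exact apply_eq_zero_of_mem_orthogonal_iSup_eigenspace hR (cfc_predicate _ R) hc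
      ((Commute.refl R).cfc_real _).symm hv
  have hsmall : ∀ ε > 0, ‖R v‖ ≤ ε * ‖v‖ := by
    intro ε hε
    let g : ℝ → ℝ := fun x => x - max (-ε) (min ε x)
    have hg : Continuous g := by fun_prop
    have hgv : cfc g R v = 0 := by
      refine cfc_apply_eq_zero_of_prod_sub hR (hfin ε hε).toFinset hg hv
        (hvanish _ (by fun_prop) fun x hx => ?_)
      by_cases hxε : ε < |x|
      · rw [Finset.prod_eq_zero (i := x) (by simp [hx, hxε]) (sub_self x), zero_mul]
      · rw [not_lt, abs_le] at hxε
        simp [g, hxε.1, hxε.2]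
    have hnorm : ‖cfc (fun x => max (-ε) (min ε x)) R‖ ≤ ε :=
      norm_cfc_le hε.le fun x _ =>
        abs_le.2 ⟨le_max_left _ _, max_le (by linarith) (min_le_left _ _)⟩
    have e : cfc g R = R - cfc (fun x => max (-ε) (min ε x)) R := by
      rw [cfc_sub (fun x => x) _ R, cfc_id' ℝ R]
    rw [e, sub_apply, sub_eq_zero] at hgv
    rw [hgv]
    exact ContinuousLinearMap.le_of_opNorm_le _ hnorm v
  have hRv : R v = 0 := by
    rw [← norm_le_zero_iff]
    refine le_of_forall_pos_le_add fun ε hε => ?_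
    refine (hsmall (ε / (‖v‖ + 1)) (by positivity)).trans ?_
    rw [zero_add, div_mul_eq_mul_div, div_le_iff₀ (by positivity)]
    nlinarith [norm_nonneg v]
  have hvE : v ∈ eigenspace (R : Module.End ℂ X) 0 := by
    rw [mem_eigenspace_iff, zero_smul]
    exact hRv
  exact inner_self_eq_zero.1 (hv v (Submodule.mem_iSup_of_mem _ hvE))

end AbstractSpectral

section HilbertBasisFamily

variable {X : Type*} [NormedAddCommGroup X] [InnerProductSpace ℂ X]

theorem Orthonormal.countable_of_hilbertBasis {ι κ : Type*} [Countable ι]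
    (b : HilbertBasis ι ℂ X) {v : κ → X} (hv : Orthonormal ℂ v) : Countable κ := by
  have hcount : ∀ i, {k | inner ℂ (v k) (b i) ≠ 0}.Countable := fun i => by
    refine (hv.inner_products_summable (x := b i)).countable_support.mono fun k hk => ?_
    simpa using hk
  have huniv : (Set.univ : Set κ) ⊆ ⋃ i, {k | inner ℂ (v k) (b i) ≠ 0} := by
    intro k _
    by_contra hk
    simp only [Set.mem_iUnion, Set.mem_ofPred_eq, not_exists, not_not] at hk
    refine hv.ne_zero k (b.repr.map_eq_zero_iff.1 ?_)
    ext i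
    rw [b.repr_apply_apply, ← inner_conj_symm, hk i]
    simp
  exact Set.countable_univ_iff.1 ((Set.countable_iUnion hcount).mono huniv)

theorem infinite_of_span_orthogonal_eq_bot {ι κ : Type*} [Infinite ι] {b : ι → X}
    (hb : Orthonormal ℂ b) {v : κ → X} (hv : (Submodule.span ℂ (Set.range v))ᗮ = ⊥) :
    Infinite κ := by
  by_contra hκ
  rw [not_infinite_iff_finite] at hκ
  have : FiniteDimensional ℂ (Submodule.span ℂ (Set.range v)) :=
    FiniteDimensional.span_of_finite ℂ (Set.finite_range v)
  have htop := Submodule.orthogonal_eq_bot_iff.1 hv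
  have : FiniteDimensional ℂ X := Module.Finite.of_surjective
    (Submodule.span ℂ (Set.range v)).subtype fun x => ⟨⟨x, htop ▸ Submodule.mem_top⟩, rfl⟩
  exact not_finite_iff_infinite.2 ‹Infinite ι› hb.linearIndependent.finite

/-- A total orthogonal family of closed subspaces of a separable infinite-dimensional Hilbert space
carries a Hilbert basis indexed by `ℕ`. -/
theorem OrthogonalFamily.exists_hilbertBasis_nat [CompleteSpace X] {ι₀ ι : Type*} [Countable ι₀]
    [Infinite ι₀] (b₀ : HilbertBasis ι₀ ℂ X) {V : ι → Submodule ℂ X}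
    (hclosed : ∀ i, IsClosed (V i : Set X))
    (hV : OrthogonalFamily ℂ (fun i => V i) fun i => (V i).subtypeₗᵢ)
    (htotal : (⨆ i, V i)ᗮ = ⊥) :
    ∃ (b : HilbertBasis ℕ ℂ X) (e : ℕ → ι), ∀ k, b k ∈ V (e k) := by
  have hcomplete : ∀ i, CompleteSpace (V i) := fun i => (hclosed i).completeSpace_coe
  choose w b hb using fun i => exists_hilbertBasis ℂ (V i)
  let v : (Σ i, w i) → X := fun a => (b a.1 a.2 : X)
  have hv : Orthonormal ℂ v := hV.orthonormal_sigma_orthonormal fun i => (b i).orthonormal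
  have hspan : (Submodule.span ℂ (Set.range v))ᗮ = ⊥ := by
    rw [Submodule.eq_bot_iff]
    intro x hx
    rw [← Submodule.mem_bot ℂ, ← htotal, ← Submodule.iInf_orthogonal, Submodule.mem_iInf]
    intro i
    rw [Submodule.mem_orthogonal']
    intro u hu
    have hsum := ((b i).hasSum_repr ⟨u, hu⟩).mapL ((innerSL ℂ x).comp (V i).subtypeL)
    refine hsum.unique ?_
    convert hasSum_zero using 2 with k
    have h0 : inner ℂ x (v ⟨i, k⟩) = 0 :=
      (Submodule.mem_orthogonal' _ _).1 hx _ (Submodule.subset_span ⟨⟨i, k⟩, rfl⟩)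
    simpa [inner_smul_right] using Or.inr h0
  have := hv.countable_of_hilbertBasis b₀
  have := infinite_of_span_orthogonal_eq_bot b₀.orthonormal hspan
  obtain ⟨f⟩ := nonempty_equiv_of_countable (α := ℕ) (β := Σ i, w i)
  refine ⟨HilbertBasis.mkOfOrthogonalEqBot (hv.comp f f.injective) ?_, fun k => (f k).1,
    fun k => ?_⟩
  · rwa [f.surjective.range_comp]
  · rw [HilbertBasis.coe_mkOfOrthogonalEqBot]
    exact (b (f k).1 (f k).2).2

end HilbertBasisFamily

section WeightedComposition

open Filter Topology

variable {α : Type*}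

theorem lp.sum_norm_mul_comp_le (c : α → ℂ) (σ : α ≃ α) {C : ℝ} (hC : 0 ≤ C)
    (hc : ∀ p, ‖c p‖ ≤ C) (φ : lp (fun _ : α => ℂ) 2) (s : Finset α) :
    ∑ p ∈ s, ‖c p * φ (σ p)‖ ^ (2 : ENNReal).toReal ≤ (C * ‖φ‖) ^ (2 : ENNReal).toReal := by
  calc ∑ p ∈ s, ‖c p * φ (σ p)‖ ^ (2 : ENNReal).toReal
      ≤ ∑ p ∈ s, C ^ (2 : ENNReal).toReal * ‖φ (σ p)‖ ^ (2 : ENNReal).toReal := by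
        refine Finset.sum_le_sum fun p _ => ?_
        rw [norm_mul, ← Real.mul_rpow hC (norm_nonneg _)]
        gcongr
        exact hc p
    _ = C ^ (2 : ENNReal).toReal *
          ∑ p ∈ s.map σ.toEmbedding, ‖φ p‖ ^ (2 : ENNReal).toReal := by
        simp [Finset.mul_sum]
    _ ≤ C ^ (2 : ENNReal).toReal * ‖φ‖ ^ (2 : ENNReal).toReal := by
        gcongr
        exact lp.sum_rpow_le_norm_rpow (by norm_num) φ _
    _ = _ := (Real.mul_rpow hC (norm_nonneg _)).symm

/-- The operator `φ ↦ c · (φ ∘ σ)` on `ℓ²(α)`, for a bounded weight `c` and a permutation `σ`. -/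
def weightedComp (c : α → ℂ) (σ : α ≃ α) (hc : ∃ C, ∀ p, ‖c p‖ ≤ C) :
    lp (fun _ : α => ℂ) 2 →L[ℂ] lp (fun _ : α => ℂ) 2 :=
  LinearMap.mkContinuousOfExistsBound
    { toFun := fun φ => ⟨fun p => c p * φ (σ p), by
        obtain ⟨C, hC⟩ := hc
        exact memℓp_gen' (lp.sum_norm_mul_comp_le c σ (le_max_right C 0)
          (fun p => (hC p).trans (le_max_left C 0)) φ)⟩
      map_add' := fun φ ψ => by
        ext p
        exact mul_add _ _ _
      map_smul' := fun a φ => by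
        ext p
        simp [mul_left_comm] }
    (by
      obtain ⟨C, hC⟩ := hc
      refine ⟨max C 0, fun φ => lp.norm_le_of_forall_sum_le (by norm_num) (by positivity) ?_⟩
      exact lp.sum_norm_mul_comp_le c σ (le_max_right C 0)
          (fun p => (hC p).trans (le_max_left C 0)) φ)

@[simp]
theorem weightedComp_apply (c : α → ℂ) (σ : α ≃ α) (hc : ∃ C, ∀ p, ‖c p‖ ≤ C)
    (φ : lp (fun _ : α => ℂ) 2) (p : α) : weightedComp c σ hc φ p = c p * φ (σ p) :=
  rfl

theorem norm_weightedComp_le (c : α → ℂ) (σ : α ≃ α) {C : ℝ} (hC : 0 ≤ C)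
    (hc : ∀ p, ‖c p‖ ≤ C) : ‖weightedComp c σ ⟨C, hc⟩‖ ≤ C :=
  ContinuousLinearMap.opNorm_le_bound _ hC fun φ =>
    lp.norm_le_of_forall_sum_le (by norm_num) (by positivity)
      (lp.sum_norm_mul_comp_le c σ hC hc φ)

theorem star_weightedComp (c : α → ℂ) (σ : α ≃ α) (hc : ∃ C, ∀ p, ‖c p‖ ≤ C) :
    star (weightedComp c σ hc) = weightedComp (fun p => star (c (σ.symm p))) σ.symm
      (hc.imp fun C hC p => by simpa using hC (σ.symm p)) := by
  rw [ContinuousLinearMap.star_eq_adjoint, eq_comm, ContinuousLinearMap.eq_adjoint_iff]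
  intro φ ψ
  rw [lp.inner_eq_tsum, lp.inner_eq_tsum, ← σ.tsum_eq]
  refine tsum_congr fun p => ?_
  simp [mul_left_comm, mul_assoc]

theorem isCompactOperator_weightedComp {c : α → ℂ} (σ : α ≃ α) (hc : ∃ C, ∀ p, ‖c p‖ ≤ C)
    (h0 : Tendsto c cofinite (𝓝 0)) : IsCompactOperator (weightedComp c σ hc) := by
  classical
  refine isClosed_setOfPred_isCompactOperator.closure_subset
    (Metric.mem_closure_iff.2 fun ε hε => ?_)
  have hfin : {p | ¬ ‖c p‖ < ε / 2}.Finite :=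
    eventually_cofinite.1 (by simpa using h0.norm.eventually_lt_const (by simpa using half_pos hε))
  let A : lp (fun _ : α => ℂ) 2 →L[ℂ] lp (fun _ : α => ℂ) 2 :=
    ∑ p ∈ hfin.toFinset, (ContinuousLinearMap.toSpanSingleton ℂ
      (lp.single (E := fun _ : α => ℂ) 2 p (c p))).comp (lp.evalCLM ℂ (fun _ : α => ℂ) 2 (σ p))
  have hA : IsCompactOperator A := by
    refine (compactOperator (RingHom.id ℂ) (lp (fun _ : α => ℂ) 2)
      (lp (fun _ : α => ℂ) 2)).sum_mem fun p _ => ?_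
    exact (isCompactOperator_of_locallyCompactSpace_dom
      (lp.evalCLM ℂ (fun _ : α => ℂ) 2 (σ p))).clm_comp
        (ContinuousLinearMap.toSpanSingleton ℂ (lp.single (E := fun _ : α => ℂ) 2 p (c p)))
  refine ⟨A, hA, ?_⟩
  have hbound : ∀ p, ‖if ‖c p‖ < ε / 2 then c p else 0‖ ≤ ε / 2 := by
    intro p
    split_ifs with hp
    · exact hp.le
    · simpa using (half_pos hε).le
  have hdiff : weightedComp c σ hc - A =
      weightedComp (fun p => if ‖c p‖ < ε / 2 then c p else 0) σ ⟨_, hbound⟩ := by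
    ext φ q
    have hAq : A φ q = if ‖c q‖ < ε / 2 then 0 else c q * φ (σ q) := by
      simp only [A, sum_apply, lp.coeFn_sum, Finset.sum_apply]
      simp [lp.evalCLM, Pi.single_apply, mul_comm, -not_lt, ite_not]
    rw [sub_apply, lp.coeFn_sub, Pi.sub_apply, hAq, weightedComp_apply, weightedComp_apply]
    split_ifs <;> simp
  rw [dist_eq_norm, hdiff]
  exact (norm_weightedComp_le _ σ (by positivity) hbound).trans_lt (half_lt_self hε)

theorem spectrum_weightedComp_refl_subset {c : α → ℝ} (hc : ∃ C, ∀ p, ‖(c p : ℂ)‖ ≤ C)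
    {K : Set ℝ} (hK : IsClosed K) (hcK : ∀ p, c p ∈ K) :
    spectrum ℝ (weightedComp (fun p => (c p : ℂ)) (Equiv.refl α) hc) ⊆ K := by
  intro x hx
  by_contra hxK
  obtain ⟨ε, hε, hball⟩ := Metric.isOpen_iff.1 hK.isOpen_compl x hxK
  have hdist : ∀ p, ε ≤ |x - c p| := fun p => by
    by_contra hp
    exact hball (by rwa [Metric.mem_ball, dist_comm, Real.dist_eq, ← not_le]) (hcK p)
  have hne : ∀ p, (x : ℂ) - c p ≠ 0 := fun p h => by
    have h' : x - c p = 0 := by exact_mod_cast h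
    have := hdist p
    rw [h', abs_zero] at this
    linarith
  have hinv : ∀ p, ‖((x : ℂ) - c p)⁻¹‖ ≤ ε⁻¹ := fun p => by
    rw [norm_inv, ← Complex.ofReal_sub, Complex.norm_real]
    exact inv_anti₀ hε (hdist p)
  refine hx ⟨⟨_, weightedComp (fun p => ((x : ℂ) - c p)⁻¹) (Equiv.refl α) ⟨_, hinv⟩, ?_, ?_⟩, rfl⟩
  · ext φ p
    have := hne p
    simp only [Algebra.algebraMap_eq_smul_one, mul_apply_eq_comp, sub_apply, smul_apply,
      one_apply_eq_self, lp.coeFn_sub, lp.coeFn_smul, Pi.sub_apply, Pi.smul_apply,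
      weightedComp_apply, Equiv.refl_apply, Complex.real_smul]
    field_simp
  · ext φ p
    have := hne p
    simp only [Algebra.algebraMap_eq_smul_one, mul_apply_eq_comp, sub_apply, smul_apply,
      one_apply_eq_self, lp.coeFn_sub, lp.coeFn_smul, Pi.sub_apply, Pi.smul_apply,
      weightedComp_apply, Equiv.refl_apply, Complex.real_smul]
    field_simp

end WeightedComposition

section Floquet

open Filter Topology

local notation "ℓ²" => lp (fun _ : ℤ × ℤ => ℂ) 2

/-- The parity correction making the unperturbed symbol odd: `1` on the even sublattice and `0` on
the odd one. -/
def paritySymbol (p : ℤ × ℤ) : ℤ := (p.1 + p.2 + 1) % 2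

/-- The symbol `n + j² - s`, where `s` is `paritySymbol`; it takes only odd values. -/
def oddSymbol (p : ℤ × ℤ) : ℤ := p.2 + p.1 ^ 2 - paritySymbol p

theorem paritySymbol_eq_zero_or_one (p : ℤ × ℤ) : paritySymbol p = 0 ∨ paritySymbol p = 1 :=
  Int.emod_two_eq_zero_or_one _

theorem oddSymbol_ne_zero (p : ℤ × ℤ) : oddSymbol p ≠ 0 := by
  have h : Even (p.1 ^ 2 - p.1) := by
    rw [sq, ← mul_sub_one]
    exact Int.even_mul_pred_self p.1
  obtain ⟨k, hk⟩ := h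
  unfold oddSymbol paritySymbol
  omega

theorem norm_inv_oddSymbol_le (p : ℤ × ℤ) : ‖(((oddSymbol p : ℝ)⁻¹ : ℝ) : ℂ)‖ ≤ 1 := by
  rw [Complex.norm_real, norm_inv]
  refine inv_le_one_of_one_le₀ ?_
  rw [Real.norm_eq_abs]
  exact_mod_cast Int.one_le_abs (oddSymbol_ne_zero p)

theorem finite_oddSymbol_mul_eq (a : ℤ × ℤ) (ha : Odd a.1) (m : ℤ) :
    {p : ℤ × ℤ | oddSymbol p * oddSymbol (p + a) = m}.Finite := by
  obtain ⟨k, hk⟩ := ha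
  have ha1 : 1 ≤ |a.1| := Int.one_le_abs (by omega)
  set L : ℤ := 2 * |m| + |a.2| + a.1 ^ 2 + 1 with hL
  refine (Set.finite_Icc ((-L, -(|m| + L ^ 2)) : ℤ × ℤ) (L, |m| + 1)).subset fun p hp => ?_
  have hp' : oddSymbol p * oddSymbol (p + a) = m := hp
  have hm : m ≠ 0 := hp' ▸ mul_ne_zero (oddSymbol_ne_zero _) (oddSymbol_ne_zero _)
  have hd := abs_le.1 (Int.le_of_dvd (abs_pos.2 hm)
    (abs_dvd_abs _ _ |>.2 (Dvd.intro _ hp')))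
  have hd' := abs_le.1 (Int.le_of_dvd (abs_pos.2 hm)
    (abs_dvd_abs _ _ |>.2 (Dvd.intro_left _ hp')))
  have hs : 0 ≤ paritySymbol p ∧ paritySymbol p ≤ 1 := by
    have := paritySymbol_eq_zero_or_one p
    omega
  have hs' : 0 ≤ paritySymbol (p + a) ∧ paritySymbol (p + a) ≤ 1 := by
    have := paritySymbol_eq_zero_or_one (p + a)
    omega
  simp only [oddSymbol, Prod.fst_add, Prod.snd_add] at hd hd'
  have ha2 := abs_le.1 (le_refl |a.2|)
  have hprod : |2 * (a.1 * p.1)| ≤ L := by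
    have hexp : (p.1 + a.1) ^ 2 = p.1 ^ 2 + 2 * (a.1 * p.1) + a.1 ^ 2 := by ring
    have := sq_nonneg a.1
    rw [abs_le]
    constructor <;> linarith
  have hj : |p.1| ≤ L := by
    rw [abs_mul, abs_mul, abs_two] at hprod
    nlinarith [abs_nonneg p.1]
  have hsq : p.1 ^ 2 ≤ L ^ 2 := sq_le_sq' (abs_le.1 hj).1 (abs_le.1 hj).2
  refine ⟨⟨(abs_le.1 hj).1, ?_⟩, ⟨(abs_le.1 hj).2, ?_⟩⟩
  · change -(|m| + L ^ 2) ≤ p.2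
    omega
  · change p.2 ≤ |m| + 1
    linarith [sq_nonneg p.1]

theorem tendsto_inv_oddSymbol_mul (a : ℤ × ℤ) (ha : Odd a.1) :
    Tendsto (fun p : ℤ × ℤ => ((oddSymbol p * oddSymbol (p + a) : ℤ) : ℂ)⁻¹) cofinite (𝓝 0) := by
  have h1 : Tendsto (fun p : ℤ × ℤ => oddSymbol p * oddSymbol (p + a)) cofinite cofinite :=
    Tendsto.cofinite_of_finite_preimage_singleton (finite_oddSymbol_mul_eq a ha)
  have h2 : Tendsto ((↑) : ℤ → ℂ) cofinite (Bornology.cobounded ℂ) := by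
    rw [← tendsto_norm_atTop_iff_cobounded]
    simpa only [Complex.norm_intCast, Real.norm_eq_abs] using!
      (tendsto_norm_cocompact_atTop (E := ℝ)).comp Int.tendsto_coe_cofinite
  exact (tendsto_inv₀_cobounded.comp h2).comp h1

/-- Translation by `a` on `ℓ²(ℤ × ℤ)`. -/
def hop (a : ℤ × ℤ) : ℓ² →L[ℂ] ℓ² :=
  weightedComp (fun _ => 1) (Equiv.addRight a) ⟨1, fun _ => by simp⟩

@[simp]
theorem hop_apply (a : ℤ × ℤ) (φ : ℓ²) (p : ℤ × ℤ) : hop a φ p = φ (p + a) :=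
  one_mul _

theorem norm_hop_le (a : ℤ × ℤ) : ‖hop a‖ ≤ 1 :=
  norm_weightedComp_le _ _ zero_le_one fun _ => by simp

theorem star_hop (a : ℤ × ℤ) : star (hop a) = hop (-a) := by
  rw [hop, star_weightedComp]
  ext φ p
  simp

/-- The off-diagonal part of the Floquet Hamiltonian as a bounded operator. -/
def hopping (δ : ℝ) : ℓ² →L[ℂ] ℓ² :=
  (δ : ℂ) • (hop (1, 1) + hop (1, -1) + hop (-1, 1) + hop (-1, -1))

theorem hopping_apply (δ : ℝ) (φ : ℓ²) (p : ℤ × ℤ) :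
    hopping δ φ p = δ * (φ (p.1 + 1, p.2 + 1) + φ (p.1 + 1, p.2 - 1) +
      φ (p.1 - 1, p.2 + 1) + φ (p.1 - 1, p.2 - 1)) := by
  change (δ : ℂ) * (hop (1, 1) φ p + hop (1, -1) φ p + hop (-1, 1) φ p + hop (-1, -1) φ p) = _
  simp only [hop_apply]
  rfl

theorem norm_hopping_le (δ : ℝ) : ‖hopping δ‖ ≤ |δ| * 4 := by
  rw [hopping, norm_smul, Complex.norm_real, Real.norm_eq_abs]
  gcongr
  refine (norm_add₃_le).trans ?_
  linarith [norm_add_le (hop (1, 1)) (hop (1, -1)), norm_hop_le (1, 1), norm_hop_le (1, -1),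
    norm_hop_le (-1, 1), norm_hop_le (-1, -1)]

theorem isSelfAdjoint_hopping (δ : ℝ) : IsSelfAdjoint (hopping δ) := by
  rw [isSelfAdjoint_iff, hopping, star_smul]
  simp only [star_add, star_hop, Prod.neg_mk, neg_neg, Complex.star_def, Complex.conj_ofReal]
  congr 1
  abel

theorem Hfl_eq_add_hopping (δ : ℝ) (φ : ℓ²) (p : ℤ × ℤ) :
    Hfl δ φ p = ((p.2 + p.1 ^ 2 : ℤ) : ℂ) * φ p + hopping δ φ p := by
  rw [hopping_apply, Hfl]

/-- The inverse of multiplication by `oddSymbol`. -/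
def invOddSymbol : ℓ² →L[ℂ] ℓ² :=
  weightedComp (fun p => (((oddSymbol p : ℝ)⁻¹ : ℝ) : ℂ)) (Equiv.refl _) ⟨1, norm_inv_oddSymbol_le⟩

theorem invOddSymbol_apply (φ : ℓ²) (p : ℤ × ℤ) :
    invOddSymbol φ p = (oddSymbol p : ℂ)⁻¹ * φ p := by
  simp [invOddSymbol]

theorem norm_invOddSymbol_le : ‖invOddSymbol‖ ≤ 1 :=
  norm_weightedComp_le _ _ zero_le_one norm_inv_oddSymbol_le

theorem isSelfAdjoint_invOddSymbol : IsSelfAdjoint invOddSymbol := by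
  rw [isSelfAdjoint_iff, invOddSymbol, star_weightedComp]
  ext φ p
  simp

theorem isCompactOperator_invOddSymbol_mul_hop_mul (a : ℤ × ℤ) (ha : Odd a.1) :
    IsCompactOperator (invOddSymbol * hop a * invOddSymbol) := by
  have hbound : ∀ p : ℤ × ℤ, ‖((oddSymbol p * oddSymbol (p + a) : ℤ) : ℂ)⁻¹‖ ≤ 1 := by
    intro p
    rw [norm_inv, Complex.norm_intCast]
    refine inv_le_one_of_one_le₀ ?_
    exact_mod_cast Int.one_le_abs (mul_ne_zero (oddSymbol_ne_zero _) (oddSymbol_ne_zero _))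
  convert isCompactOperator_weightedComp (Equiv.addRight a) ⟨1, hbound⟩
    (tendsto_inv_oddSymbol_mul a ha)
  ext φ p
  simp [invOddSymbol_apply, mul_apply_eq_comp, mul_assoc, mul_left_comm]

theorem isCompactOperator_invOddSymbol_mul_hopping_mul (δ : ℝ) :
    IsCompactOperator (invOddSymbol * hopping δ * invOddSymbol) := by
  simp only [hopping, mul_smul_comm, smul_mul_assoc, mul_add, add_mul]
  refine IsCompactOperator.smul (f := ⇑(invOddSymbol * hop (1, 1) * invOddSymbol +
    invOddSymbol * hop (1, -1) * invOddSymbol + invOddSymbol * hop (-1, 1) * invOddSymbol +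
    invOddSymbol * hop (-1, -1) * invOddSymbol)) ?_ (δ : ℂ)
  exact (((isCompactOperator_invOddSymbol_mul_hop_mul _ (by decide)).add
    (isCompactOperator_invOddSymbol_mul_hop_mul _ (by decide))).add
    (isCompactOperator_invOddSymbol_mul_hop_mul _ (by decide))).add
    (isCompactOperator_invOddSymbol_mul_hop_mul _ (by decide))

theorem finite_spectrum_invOddSymbol {ε : ℝ} (hε : 0 < ε) :
    {x ∈ spectrum ℝ invOddSymbol | ε < |x|}.Finite := by
  have htend : Tendsto (fun m : ℤ => (m : ℝ)⁻¹) cofinite (𝓝 0) := by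
    refine tendsto_inv₀_cobounded.comp ?_
    rw [Metric.cobounded_eq_cocompact]
    exact Int.tendsto_coe_cofinite
  have hsub := spectrum_weightedComp_refl_subset ⟨1, norm_inv_oddSymbol_le⟩
    htend.isCompact_insert_range_of_cofinite.isClosed fun p => Or.inr ⟨oddSymbol p, rfl⟩
  have hfin : {m : ℤ | ¬ |(m : ℝ)⁻¹| < ε}.Finite :=
    eventually_cofinite.1 (by simpa using htend.abs.eventually_lt_const (by simpa using hε))
  refine (hfin.image fun m : ℤ => (m : ℝ)⁻¹).subset ?_
  rintro x ⟨hx, hxε⟩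
  obtain rfl | ⟨m, rfl⟩ := hsub hx
  · rw [abs_zero] at hxε
    exact absurd hxε hε.not_gt
  · exact ⟨m, not_lt.2 hxε.le, rfl⟩

/-- Abstract second resolvent identity: if `B` is self-adjoint with `‖B R₀‖ < 1`, the inverse of
`R₀⁻¹ + B` is a self-adjoint bounded operator. -/
theorem exists_isSelfAdjoint_resolvent {X : Type*} [NormedRing X] [CompleteSpace X] [StarRing X]
    {R₀ B : X} (hR₀ : IsSelfAdjoint R₀) (hB : IsSelfAdjoint B) (h : ‖B * R₀‖ < 1) :
    ∃ R, IsSelfAdjoint R ∧ R = R₀ - R₀ * B * R ∧ R - R₀ = (R * B - 1) * (R₀ * B * R₀) := by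
  let T : Xˣ := Units.oneSub (-(B * R₀)) (by rwa [norm_neg])
  have hT : (T : X) = 1 + B * R₀ := by simp [T]
  have hRT : R₀ * ↑T⁻¹ * (T : X) = R₀ := by simp [mul_assoc]
  have hstar : star (T : X) * R₀ = R₀ * T := by
    rw [hT, star_add, star_mul, hB.star_eq, hR₀.star_eq, star_one]
    noncomm_ring
  have hR : IsSelfAdjoint (R₀ * ↑T⁻¹) := by
    rw [isSelfAdjoint_iff, ← T.mul_left_inj, hRT, star_mul, hR₀.star_eq, mul_assoc, ← hstar,
      ← mul_assoc, ← star_mul, T.mul_inv, star_one, one_mul]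
  set R := R₀ * ↑T⁻¹
  rw [hT, mul_add, mul_one] at hRT
  have hleft : R = R₀ - R * (B * R₀) := eq_sub_of_add_eq hRT
  have hright : R = R₀ - R₀ * B * R := by
    have := congrArg star hleft
    rwa [hR.star_eq, star_sub, star_mul, star_mul, hR.star_eq, hB.star_eq, hR₀.star_eq] at this
  refine ⟨R, hR, hright, ?_⟩
  calc R - R₀ = -(R * (B * R₀)) := by rw [sub_eq_iff_eq_add', ← sub_eq_add_neg]; exact hleft
    _ = -((R₀ - R * (B * R₀)) * (B * R₀)) := by rw [← hleft]
    _ = _ := by noncomm_ring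

/-- The space of square-summable solutions of `Hφ = Eφ`. -/
def floquetEigenspace (δ E : ℝ) : Submodule ℂ ℓ² where
  carrier := {φ | ∀ p, Hfl δ φ p = E * φ p}
  add_mem' {φ ψ} hφ hψ p := by
    have h1 := hφ p
    have h2 := hψ p
    rw [Hfl_eq_add_hopping] at h1 h2
    change Hfl δ (φ + ψ : ℓ²) p = E * (φ + ψ : ℓ²) p
    rw [Hfl_eq_add_hopping, map_add, lp.coeFn_add, lp.coeFn_add, Pi.add_apply, Pi.add_apply]
    linear_combination h1 + h2
  zero_mem' p := by simp [Hfl]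
  smul_mem' a φ hφ p := by
    have h1 := hφ p
    rw [Hfl_eq_add_hopping] at h1
    change Hfl δ (a • φ : ℓ²) p = E * (a • φ : ℓ²) p
    rw [Hfl_eq_add_hopping, map_smul, lp.coeFn_smul, lp.coeFn_smul, Pi.smul_apply, Pi.smul_apply,
      smul_eq_mul, smul_eq_mul]
    linear_combination a * h1

theorem mem_floquetEigenspace {δ E : ℝ} {φ : ℓ²} :
    φ ∈ floquetEigenspace δ E ↔ ∀ p, Hfl δ φ p = E * φ p :=
  Iff.rfl

theorem isClosed_floquetEigenspace (δ E : ℝ) : IsClosed (floquetEigenspace δ E : Set ℓ²) := by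
  have h : (floquetEigenspace δ E : Set ℓ²) = ⋂ p, {φ : ℓ² | Hfl δ φ p = E * φ p} := by
    ext φ
    simp [mem_floquetEigenspace]
  have heval : ∀ p, Continuous fun φ : ℓ² => φ p :=
    fun p => (lp.evalCLM ℂ (fun _ : ℤ × ℤ => ℂ) 2 p).continuous
  rw [h]
  refine isClosed_iInter fun p => isClosed_eq ?_ (continuous_const.mul (heval p))
  simp only [Hfl_eq_add_hopping]
  exact (continuous_const.mul (heval p)).add ((heval p).comp (hopping δ).continuous)

theorem orthogonalFamily_floquetEigenspace (δ : ℝ) :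
    OrthogonalFamily ℂ (fun E => floquetEigenspace δ E)
      fun E => (floquetEigenspace δ E).subtypeₗᵢ := by
  rintro E F hEF ⟨φ, hφ⟩ ⟨ψ, hψ⟩
  change inner ℂ φ ψ = 0
  have hdiag : inner ℂ ((E : ℂ) • φ - hopping δ φ) ψ = inner ℂ φ ((F : ℂ) • ψ - hopping δ ψ) := by
    rw [lp.inner_eq_tsum, lp.inner_eq_tsum]
    refine tsum_congr fun p => ?_
    have h1 : ((E : ℂ) • φ - hopping δ φ) p = ((p.2 + p.1 ^ 2 : ℤ) : ℂ) * φ p := by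
      have := mem_floquetEigenspace.1 hφ p
      rw [Hfl_eq_add_hopping] at this
      exact sub_eq_of_eq_add this.symm
    have h2 : ((F : ℂ) • ψ - hopping δ ψ) p = ((p.2 + p.1 ^ 2 : ℤ) : ℂ) * ψ p := by
      have := mem_floquetEigenspace.1 hψ p
      rw [Hfl_eq_add_hopping] at this
      exact sub_eq_of_eq_add this.symm
    rw [h1, h2]
    simp only [RCLike.inner_apply, map_mul, map_intCast]
    ring
  have hsymm : inner ℂ (hopping δ φ) ψ = inner ℂ φ (hopping δ ψ) :=
    (isSelfAdjoint_hopping δ).isSymmetric φ ψ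
  rw [inner_sub_left, inner_sub_right, hsymm, sub_left_inj, inner_smul_left, inner_smul_right,
    Complex.conj_ofReal] at hdiag
  have hne : (E : ℂ) - F ≠ 0 := by
    rw [sub_ne_zero]
    exact_mod_cast hEF
  have hmul : ((E : ℂ) - F) * inner ℂ φ ψ = 0 := by linear_combination hdiag
  exact (mul_eq_zero.1 hmul).resolve_left hne

/-- The projection onto the even sublattice. -/
def evenProj : ℓ² →L[ℂ] ℓ² :=
  weightedComp (fun p => (paritySymbol p : ℂ)) (Equiv.refl _) ⟨1, fun p => by
    obtain h | h := paritySymbol_eq_zero_or_one p <;> simp [h]⟩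

theorem evenProj_apply (φ : ℓ²) (p : ℤ × ℤ) : evenProj φ p = paritySymbol p * φ p :=
  rfl

theorem hopping_evenProj_apply (δ : ℝ) (φ : ℓ²) (p : ℤ × ℤ) :
    hopping δ (evenProj φ) p = paritySymbol p * hopping δ φ p := by
  have h1 : paritySymbol (p.1 + 1, p.2 + 1) = paritySymbol p := by
    simp only [paritySymbol]; omega
  have h2 : paritySymbol (p.1 + 1, p.2 - 1) = paritySymbol p := by
    simp only [paritySymbol]; omega
  have h3 : paritySymbol (p.1 - 1, p.2 + 1) = paritySymbol p := by
    simp only [paritySymbol]; omega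
  have h4 : paritySymbol (p.1 - 1, p.2 - 1) = paritySymbol p := by
    simp only [paritySymbol]; omega
  simp only [hopping_apply, evenProj_apply, h1, h2, h3, h4]
  ring

theorem mem_iSup_floquetEigenspace {δ e : ℝ} {v : ℓ²}
    (hv : ∀ p, (oddSymbol p : ℂ) * v p + hopping δ v p = e * v p) :
    v ∈ ⨆ E, floquetEigenspace δ E := by
  have hsq : ∀ p, (paritySymbol p : ℂ) * paritySymbol p = paritySymbol p := fun p => by
    obtain h | h := paritySymbol_eq_zero_or_one p <;> simp [h]
  have heven : evenProj v ∈ floquetEigenspace δ (e + 1) := by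
    intro p
    have := hv p
    rw [Hfl_eq_add_hopping, hopping_evenProj_apply, evenProj_apply]
    simp only [oddSymbol] at this
    push_cast at this ⊢
    linear_combination (paritySymbol p : ℂ) * this + v p * hsq p
  have hodd : v - evenProj v ∈ floquetEigenspace δ e := by
    intro p
    have := hv p
    rw [Hfl_eq_add_hopping, map_sub, lp.coeFn_sub, lp.coeFn_sub, Pi.sub_apply, Pi.sub_apply,
      hopping_evenProj_apply, evenProj_apply]
    simp only [oddSymbol] at this
    push_cast at this ⊢
    linear_combination (1 - (paritySymbol p : ℂ)) * this - v p * hsq p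
  rw [← sub_add_cancel v (evenProj v)]
  exact add_mem (Submodule.mem_iSup_of_mem e hodd) (Submodule.mem_iSup_of_mem (e + 1) heven)

theorem orthogonal_iSup_floquetEigenspace_eq_bot {δ : ℝ} (hδ : |δ| < 1 / 4) :
    (⨆ E, floquetEigenspace δ E)ᗮ = ⊥ := by
  have hnorm : ‖hopping δ * invOddSymbol‖ < 1 := by
    refine (norm_mul_le _ _).trans_lt ?_
    have := mul_le_mul (norm_hopping_le δ) norm_invOddSymbol_le (norm_nonneg _) (by positivity)
    linarith
  obtain ⟨R, hR, hres, hdiff⟩ := exists_isSelfAdjoint_resolvent isSelfAdjoint_invOddSymbol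
    (isSelfAdjoint_hopping δ) hnorm
  have hcompact : IsCompactOperator (R - invOddSymbol) := by
    rw [hdiff]
    exact (isCompactOperator_invOddSymbol_mul_hopping_mul δ).clm_comp (R * hopping δ - 1)
  have hpoint : ∀ v p, (oddSymbol p : ℂ) * R v p + hopping δ (R v) p = v p := by
    intro v p
    have h : R v p = invOddSymbol v p - invOddSymbol (hopping δ (R v)) p :=
      congrArg (fun A : ℓ² →L[ℂ] ℓ² => A v p) hres
    rw [invOddSymbol_apply, invOddSymbol_apply] at h
    have hne : (oddSymbol p : ℂ) ≠ 0 := by exact_mod_cast oddSymbol_ne_zero p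
    rw [h]
    field_simp
    ring
  rw [← le_bot_iff, ← orthogonal_iSup_eigenspace_eq_bot_of_isCompactOperator_sub hR
    isSelfAdjoint_invOddSymbol hcompact fun ε hε => finite_spectrum_invOddSymbol hε]
  refine Submodule.orthogonal_le (iSup_le fun μ v hv => ?_)
  obtain rfl | hv0 := eq_or_ne v 0
  · exact zero_mem _
  have hRv : R v = μ • v := Module.End.mem_eigenspace_iff.1 hv
  have hμ : μ ≠ 0 := by
    rintro rfl
    refine hv0 (lp.ext (funext fun p => ?_))
    rw [← hpoint v p, hRv]
    simp
  have hreal : (μ.re : ℂ) = μ := Complex.conj_eq_iff_re.1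
    (hR.isSymmetric.conj_eigenvalue_eq_self
      (Module.End.hasEigenvalue_of_hasEigenvector ⟨hv, hv0⟩))
  refine mem_iSup_floquetEigenspace (e := μ.re⁻¹) fun p => ?_
  have h := hpoint v p
  rw [hRv, map_smul, lp.coeFn_smul, lp.coeFn_smul, Pi.smul_apply, Pi.smul_apply, smul_eq_mul,
    smul_eq_mul] at h
  rw [Complex.ofReal_inv, hreal]
  field_simp
  linear_combination h

end Floquet

/-- Lemma 2.1: for `|δ| < 1/4` the Floquet Hamiltonian has pure point
spectrum: there is an orthonormal Hilbert basis of `ℓ²(ℤ×ℤ; ℂ)` consisting of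
eigenfunctions of `H` with real eigenvalues. -/
theorem floquet_pure_point_spectrum (δ : ℝ) (hδ : |δ| < 1 / 4) :
    ∃ (b : HilbertBasis ℕ ℂ (lp (fun _ : ℤ × ℤ => ℂ) 2)) (E : ℕ → ℝ),
      ∀ (k : ℕ) (p : ℤ × ℤ),
        Hfl δ (b k : ∀ _ : ℤ × ℤ, ℂ) p = (E k : ℂ) * (b k : ∀ _ : ℤ × ℤ, ℂ) p := by
  obtain ⟨b, E, hbE⟩ := (orthogonalFamily_floquetEigenspace δ).exists_hilbertBasis_nat
    (HilbertBasis.ofRepr (LinearIsometryEquiv.refl ℂ (lp (fun _ : ℤ × ℤ => ℂ) 2)))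
    (isClosed_floquetEigenspace δ) (orthogonal_iSup_floquetEigenspace_eq_bot hδ)
  exact ⟨b, E, hbE⟩
end
end

section
/- For every δ ≥ 0, if φ ∈ ℓ²(ℤ×ℤ;ℂ) is a nonzero eigenfunction of the Floquet Hamiltonian H with eigenvalue E ∈ ℝ, then there exists N ∈ ℤ with |E − N| ≤ 4δ; i.e., the ℓ² eigenvalues of H lie within distance 4δ of the integers. -/
noncomputable section

lemma norm_four_add_sq_le {V : Type*} [SeminormedAddCommGroup V] (a b c d : V) :
    ‖a + b + c + d‖ ^ 2 ≤ 4 * (‖a‖ ^ 2 + ‖b‖ ^ 2 + ‖c‖ ^ 2 + ‖d‖ ^ 2) := by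
  have h : ‖a + b + c + d‖ ≤ ‖a‖ + ‖b‖ + ‖c‖ + ‖d‖ :=
    (norm_add_le _ _).trans (by gcongr; exact norm_add₃_le)
  calc ‖a + b + c + d‖ ^ 2 ≤ (‖a‖ + ‖b‖ + ‖c‖ + ‖d‖) ^ 2 := by gcongr
    _ ≤ _ := by
      nlinarith [sq_nonneg (‖a‖ - ‖b‖), sq_nonneg (‖a‖ - ‖c‖), sq_nonneg (‖a‖ - ‖d‖),
        sq_nonneg (‖b‖ - ‖c‖), sq_nonneg (‖b‖ - ‖d‖), sq_nonneg (‖c‖ - ‖d‖)]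

/-- The eigenvalue equation bounds `φ p` pointwise by its neighbours, with the distance from `E`
to the integers as a constant. -/
lemma Hfl_eigenfunction_norm_sq_le (δ : ℝ) (φ : ℤ × ℤ → ℂ) (E : ℝ) (p : ℤ × ℤ)
    (heig : Hfl δ φ p = (E : ℂ) * φ p) :
    (E - round E) ^ 2 * ‖φ p‖ ^ 2 ≤
      4 * δ ^ 2 * (‖φ (p + (1, 1))‖ ^ 2 + ‖φ (p + (1, -1))‖ ^ 2 +
        ‖φ (p + (-1, 1))‖ ^ 2 + ‖φ (p + (-1, -1))‖ ^ 2) := by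
  set S := φ (p + (1, 1)) + φ (p + (1, -1)) + φ (p + (-1, 1)) + φ (p + (-1, -1)) with hS
  have h : ((E - ((p.2 + p.1 ^ 2 : ℤ) : ℝ) : ℝ) : ℂ) * φ p = (δ : ℂ) * S := by
    change _ * φ p + (δ : ℂ) * S = _ at heig
    rw [Complex.ofReal_sub, Complex.ofReal_intCast]
    linear_combination -heig
  have hn : (E - ((p.2 + p.1 ^ 2 : ℤ) : ℝ)) ^ 2 * ‖φ p‖ ^ 2 = δ ^ 2 * ‖S‖ ^ 2 := by
    have := congrArg (fun z => ‖z‖ ^ 2) h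
    simpa only [norm_mul, Complex.norm_real, Real.norm_eq_abs, mul_pow, sq_abs] using this
  calc (E - round E) ^ 2 * ‖φ p‖ ^ 2
      ≤ (E - ((p.2 + p.1 ^ 2 : ℤ) : ℝ)) ^ 2 * ‖φ p‖ ^ 2 :=
        mul_le_mul_of_nonneg_right (sq_le_sq.2 (round_le E _)) (sq_nonneg _)
    _ = δ ^ 2 * ‖S‖ ^ 2 := hn
    _ ≤ δ ^ 2 * (4 * _) := mul_le_mul_of_nonneg_left (norm_four_add_sq_le _ _ _ _) (sq_nonneg _)
    _ = _ := by ring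

/-- every ℓ² eigenvalue of the Floquet Hamiltonian lies within
distance `4δ` of the integers. -/
theorem floquet_eigenvalues_near_integers (δ : ℝ) (hδ : 0 ≤ δ)
    (φ : ℤ × ℤ → ℂ) (E : ℝ) (hφ : Memℓp φ 2) (hφ0 : φ ≠ 0)
    (heig : ∀ p : ℤ × ℤ, Hfl δ φ p = (E : ℂ) * φ p) :
    ∃ N : ℤ, |E - (N : ℝ)| ≤ 4 * δ := by
  refine ⟨round E, abs_le_of_sq_le_sq ?_ (by positivity)⟩
  have hs : Summable fun p => ‖φ p‖ ^ 2 := by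
    simpa using hφ.summable (by simp)
  obtain ⟨q, hq⟩ := Function.ne_iff.1 hφ0
  have hpos : 0 < ∑' p, ‖φ p‖ ^ 2 :=
    hs.tsum_pos (fun p => sq_nonneg _) q (pow_pos (norm_pos_iff.2 hq) 2)
  have hshift (v : ℤ × ℤ) : HasSum (fun p => ‖φ (p + v)‖ ^ 2) (∑' p, ‖φ p‖ ^ 2) :=
    (Equiv.addRight v).hasSum_iff.2 hs.hasSum
  have hle := hasSum_le (fun p => Hfl_eigenfunction_norm_sq_le δ φ E p (heig p))
    (hs.hasSum.mul_left _)
    (((((hshift (1, 1)).add (hshift (1, -1))).add (hshift (-1, 1))).add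
      (hshift (-1, -1))).mul_left (4 * δ ^ 2))
  refine le_of_mul_le_mul_right (hle.trans_eq ?_) hpos
  ring
end
end

section
/- For every δ with 0 < δ < 1/4 there exists j₀ > 0 such that for every (j,n) ∈ P with |j| > j₀ and every admissible integer L with |j| ≤ L ≤ 2(|j|−1), the real symmetric matrix H_{Λ_j} has exactly one eigenvalue, counted with multiplicity, in the interval [−2δ, 2δ]. -/
noncomputable section

/-- The finite-volume Floquet Hamiltonian `H_S` on a finite set `S ⊆ ℤ × ℤ`:
diagonal entries `n + j²`, entries `δ` between `(j,n)` and `(j',n')` with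
`|j−j'| = 1` and `|n−n'| = 1`, all other entries `0`. -/
def Hmat (δ : ℝ) (S : Finset (ℤ × ℤ)) : Matrix S S ℝ := fun x y =>
  if (x : ℤ × ℤ) = (y : ℤ × ℤ) then (((x : ℤ × ℤ).2 + (x : ℤ × ℤ).1 ^ 2 : ℤ) : ℝ)
  else if |(x : ℤ × ℤ).1 - (y : ℤ × ℤ).1| = 1 ∧ |(x : ℤ × ℤ).2 - (y : ℤ × ℤ).2| = 1 then δ
  else 0

/-- `μ` is an eigenvalue of the real symmetric matrix `H_S`. -/
def IsEigen (δ : ℝ) (S : Finset (ℤ × ℤ)) (μ : ℝ) : Prop :=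
  ∃ v : S → ℝ, v ≠ 0 ∧ (Hmat δ S).mulVec v = μ • v

/-- The square `Λ_j` of side `2L` centered at `(j, n)`. -/
def sqΛ (j n L : ℤ) : Finset (ℤ × ℤ) :=
  Finset.Icc (j - L) (j + L) ×ˢ Finset.Icc (n - L) (n + L)

open Matrix in
/-- A real symmetric matrix has an eigenvalue in `[-r, r]` if it has an approximate kernel vector
of quality `r`. -/
theorem exists_eigenvalue_sq_le {ι : Type*} [Fintype ι] [DecidableEq ι] {A : Matrix ι ι ℝ}
    (hA : A.IsHermitian) {v : ι → ℝ} (hv : v ≠ 0) {r : ℝ}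
    (h : ∑ x, (A *ᵥ v) x ^ 2 ≤ r ^ 2 * ∑ x, v x ^ 2) :
    ∃ i, hA.eigenvalues i ^ 2 ≤ r ^ 2 := by
  by_contra! hlt
  have parseval (w : ι → ℝ) : ∑ i, (⇑(hA.eigenvectorBasis i) ⬝ᵥ w) ^ 2 = ∑ x, w x ^ 2 := by
    have := hA.eigenvectorBasis.sum_sq_norm_inner_right (WithLp.toLp 2 w)
    rw [EuclideanSpace.real_norm_sq_eq] at this
    simpa [EuclideanSpace.inner_eq_star_dotProduct, dotProduct_comm] using this
  have coeff (i : ι) : ⇑(hA.eigenvectorBasis i) ⬝ᵥ (A *ᵥ v) =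
      hA.eigenvalues i * (⇑(hA.eigenvectorBasis i) ⬝ᵥ v) := by
    have hT : Aᵀ = A := by simpa [IsHermitian, conjTranspose_eq_transpose_of_trivial] using hA
    rw [dotProduct_mulVec, ← mulVec_transpose, hT, hA.mulVec_eigenvectorBasis, smul_dotProduct,
      smul_eq_mul]
  have hpos : 0 < ∑ x, v x ^ 2 := by
    obtain ⟨x, hx⟩ := Function.ne_iff.mp hv
    exact Finset.sum_pos' (fun _ _ => sq_nonneg _) ⟨x, Finset.mem_univ _, by
      have : v x ≠ 0 := hx
      positivity⟩
  rw [← parseval (A *ᵥ v), ← parseval v, Finset.mul_sum] at h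
  rw [← parseval] at hpos
  obtain ⟨i, -, hi⟩ := Finset.exists_ne_zero_of_sum_ne_zero hpos.ne'
  refine absurd h (not_le.mpr (Finset.sum_lt_sum (fun k _ => ?_) ⟨i, Finset.mem_univ _, ?_⟩))
  · rw [coeff, mul_pow]
    exact mul_le_mul_of_nonneg_right (hlt k).le (sq_nonneg _)
  · rw [coeff, mul_pow]
    exact mul_lt_mul_of_pos_right (hlt i) (lt_of_le_of_ne (sq_nonneg _) hi.symm)

open Matrix in
/-- Two eigenvalues in `[-r, r]` give an approximate kernel vector of quality `r` that vanishes at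
a prescribed index. -/
theorem exists_vanishing_of_two_eigenvalues {ι : Type*} [Fintype ι] [DecidableEq ι]
    {A : Matrix ι ι ℝ} (hA : A.IsHermitian) {i k : ι} (hik : i ≠ k) {r : ℝ}
    (hi : hA.eigenvalues i ^ 2 ≤ r ^ 2) (hk : hA.eigenvalues k ^ 2 ≤ r ^ 2) (x₀ : ι) :
    ∃ v : ι → ℝ, v x₀ = 0 ∧ 0 < ∑ x, v x ^ 2 ∧
      ∑ x, (A *ᵥ v) x ^ 2 ≤ r ^ 2 * ∑ x, v x ^ 2 := by
  set u : ι → ℝ := ⇑(hA.eigenvectorBasis i) with hu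
  set w : ι → ℝ := ⇑(hA.eigenvectorBasis k) with hw
  have norm_one (l : ι) : ∑ x, (hA.eigenvectorBasis l) x ^ 2 = 1 := by
    rw [← EuclideanSpace.real_norm_sq_eq, hA.eigenvectorBasis.orthonormal.1 l, one_pow]
  have orth : ∑ x, u x * w x = 0 := by
    have := hA.eigenvectorBasis.orthonormal.2 hik
    simpa [EuclideanSpace.inner_eq_star_dotProduct, dotProduct, mul_comm, hu, hw] using this
  have pyth (a b : ℝ) : ∑ x, (a * u x + b * w x) ^ 2 = a ^ 2 + b ^ 2 := by
    calc ∑ x, (a * u x + b * w x) ^ 2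
        = a ^ 2 * ∑ x, u x ^ 2 + 2 * a * b * ∑ x, u x * w x + b ^ 2 * ∑ x, w x ^ 2 := by
          simp only [Finset.mul_sum, ← Finset.sum_add_distrib]
          exact Finset.sum_congr rfl fun x _ => by ring
      _ = a ^ 2 + b ^ 2 := by rw [orth, hu, hw, norm_one, norm_one]; ring
  have image (a b : ℝ) : A *ᵥ (fun x => a * u x + b * w x) =
      fun x => a * hA.eigenvalues i * u x + b * hA.eigenvalues k * w x := by
    have : (fun x => a * u x + b * w x) = a • u + b • w := rfl
    rw [this, mulVec_add, mulVec_smul, mulVec_smul, hu, hw, hA.mulVec_eigenvectorBasis,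
      hA.mulVec_eigenvectorBasis]
    ext x
    simp [mul_assoc]
  obtain ⟨a, b, hab, h0⟩ : ∃ a b : ℝ, 0 < a ^ 2 + b ^ 2 ∧ a * u x₀ + b * w x₀ = 0 := by
    by_cases h : u x₀ = 0
    · exact ⟨1, 0, by norm_num, by simp [h]⟩
    · exact ⟨w x₀, -u x₀, by nlinarith [sq_nonneg (w x₀), sq_pos_of_ne_zero h], by ring⟩
  refine ⟨fun x => a * u x + b * w x, h0, by rwa [pyth], ?_⟩
  rw [image, pyth, pyth]
  nlinarith [mul_le_mul_of_nonneg_left hi (sq_nonneg a), mul_le_mul_of_nonneg_left hk (sq_nonneg b)]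

/-- The sum of `w` over the four diagonal neighbours of `x`. -/
def diagSum (w : ℤ × ℤ → ℝ) (x : ℤ × ℤ) : ℝ :=
  w (x + (1, 1)) + w (x + (1, -1)) + w (x + (-1, 1)) + w (x + (-1, -1))

theorem diagSum_sq_le (w : ℤ × ℤ → ℝ) (x : ℤ × ℤ) :
    diagSum w x ^ 2 ≤ 4 * diagSum (fun y => w y ^ 2) x := by
  unfold diagSum
  set a := w (x + (1, 1))
  set b := w (x + (1, -1))
  set c := w (x + (-1, 1))
  set d := w (x + (-1, -1))
  nlinarith [sq_nonneg (a - b), sq_nonneg (a - c), sq_nonneg (a - d), sq_nonneg (b - c),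
    sq_nonneg (b - d), sq_nonneg (c - d)]

theorem sum_shift_le (S T : Finset (ℤ × ℤ)) {f : ℤ × ℤ → ℝ} (hf : ∀ x, 0 ≤ f x)
    (hS : ∀ x ∉ S, f x = 0) (d : ℤ × ℤ) : ∑ x ∈ T, f (x + d) ≤ ∑ x ∈ S, f x := by
  classical
  rw [← Finset.sum_image (f := f) (g := fun x => x + d) (fun a _ b _ h => add_right_cancel h)]
  calc ∑ y ∈ T.image fun x => x + d, f y
      ≤ ∑ y ∈ (T.image fun x => x + d) ∪ S, f y :=
        Finset.sum_le_sum_of_subset_of_nonneg Finset.subset_union_left fun x _ _ => hf x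
    _ = ∑ y ∈ S, f y :=
        (Finset.sum_subset Finset.subset_union_right fun x _ hx => hS x hx).symm

theorem sum_diagSum_le (S T : Finset (ℤ × ℤ)) {f : ℤ × ℤ → ℝ} (hf : ∀ x, 0 ≤ f x)
    (hS : ∀ x ∉ S, f x = 0) : ∑ x ∈ T, diagSum f x ≤ 4 * ∑ x ∈ S, f x := by
  simp only [diagSum, Finset.sum_add_distrib]
  linarith [sum_shift_le S T hf hS (1, 1), sum_shift_le S T hf hS (1, -1),
    sum_shift_le S T hf hS (-1, 1), sum_shift_le S T hf hS (-1, -1)]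

/-- The action of `H_S` on a vector given by a function on `ℤ × ℤ` supported in `S`. -/
theorem Hmat_mulVec (δ : ℝ) (S : Finset (ℤ × ℤ)) {w : ℤ × ℤ → ℝ} (hw : ∀ x ∉ S, w x = 0) (x : S) :
    (Hmat δ S).mulVec (fun y => w y) x =
      (((x : ℤ × ℤ).2 + (x : ℤ × ℤ).1 ^ 2 : ℤ) : ℝ) * w x + δ * diagSum w x := by
  obtain ⟨⟨p, q⟩, hx⟩ := x
  have entry (y : ℤ × ℤ) : (if (p, q) = y then ((q + p ^ 2 : ℤ) : ℝ)
        else if |p - y.1| = 1 ∧ |q - y.2| = 1 then δ else 0) * w y =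
      (if (p, q) = y then ((q + p ^ 2 : ℤ) : ℝ) * w y else 0) +
      δ * ((if (p, q) + (1, 1) = y then w y else 0) + (if (p, q) + (1, -1) = y then w y else 0) +
        (if (p, q) + (-1, 1) = y then w y else 0) + (if (p, q) + (-1, -1) = y then w y else 0)) := by
    obtain ⟨a, b⟩ := y
    simp only [Prod.mk.injEq, Prod.mk_add_mk, abs_eq (zero_le_one' ℤ)]
    split_ifs <;> first | omega | ring
  have pick (z : ℤ × ℤ) : ∑ y ∈ S, (if z = y then w y else 0) = w z := by
    rw [Finset.sum_ite_eq]
    split_ifs with h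
    · rfl
    · exact (hw z h).symm
  calc (Hmat δ S).mulVec (fun y => w y) ⟨(p, q), hx⟩
      = ∑ y ∈ S, (if (p, q) = y then ((q + p ^ 2 : ℤ) : ℝ)
          else if |p - y.1| = 1 ∧ |q - y.2| = 1 then δ else 0) * w y :=
        Finset.sum_coe_sort S (fun y => (if (p, q) = y then ((q + p ^ 2 : ℤ) : ℝ)
          else if |p - y.1| = 1 ∧ |q - y.2| = 1 then δ else 0) * w y)
    _ = _ := by
        simp only [entry, Finset.sum_add_distrib, ← Finset.mul_sum, pick, Finset.sum_ite_eq, hx,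
          if_true, diagSum]

/-- If the diagonal `D` is at least `1` in absolute value on the support of `w`, and no two diagonal
neighbours in `S` both have `|D| < 4`, then `D + δ·diagSum` is bounded below by `2δ` on `w`. -/
theorem sum_sq_lower_bound {δ : ℝ} (hδ0 : 0 < δ) (hδ1 : δ < 1 / 4) (S : Finset (ℤ × ℤ))
    {w D : ℤ × ℤ → ℝ} (hw : ∀ x ∉ S, w x = 0) (hpos : 0 < ∑ x ∈ S, w x ^ 2)
    (hD : ∀ x ∈ S, w x ≠ 0 → 1 ≤ D x ^ 2)
    (hsep : ∀ x ∈ S, D x ^ 2 < 16 → ∀ d ∈ ({(1, 1), (1, -1), (-1, 1), (-1, -1)} : Finset (ℤ × ℤ)),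
      x + d ∈ S → 16 ≤ D (x + d) ^ 2) :
    (2 * δ) ^ 2 * ∑ x ∈ S, w x ^ 2 < ∑ x ∈ S, (D x * w x + δ * diagSum w x) ^ 2 := by
  by_contra! hle
  set V := ∑ x ∈ S, w x ^ 2 with hV
  set R := ∑ x ∈ S, (D x * w x + δ * diagSum w x) ^ 2 with hR
  set q : ℤ × ℤ → ℝ := fun x => if 16 ≤ D x ^ 2 then w x else 0 with hq
  have hqS : ∀ x ∉ S, q x ^ 2 = 0 := fun x hx => by simp [hq, hw x hx]
  have hδ : δ ^ 2 ≤ 1 / 16 := by nlinarith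
  have hA : ∑ x ∈ S, diagSum w x ^ 2 ≤ 16 * V := by
    calc ∑ x ∈ S, diagSum w x ^ 2 ≤ ∑ x ∈ S, 4 * diagSum (fun y => w y ^ 2) x :=
          Finset.sum_le_sum fun x _ => diagSum_sq_le w x
      _ ≤ 16 * V := by
          rw [← Finset.mul_sum]
          linarith [sum_diagSum_le S S (f := fun y => w y ^ 2) (fun _ => sq_nonneg _)
            (fun x hx => by simp [hw x hx])]
  have hAq : ∑ x ∈ S, diagSum q x ^ 2 ≤ 16 * ∑ x ∈ S, q x ^ 2 := by
    calc ∑ x ∈ S, diagSum q x ^ 2 ≤ ∑ x ∈ S, 4 * diagSum (fun y => q y ^ 2) x :=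
          Finset.sum_le_sum fun x _ => diagSum_sq_le q x
      _ ≤ 16 * ∑ x ∈ S, q x ^ 2 := by
          rw [← Finset.mul_sum]
          linarith [sum_diagSum_le S S (f := fun y => q y ^ 2) (fun _ => sq_nonneg _) hqS]
  have far : 16 * ∑ x ∈ S, q x ^ 2 ≤ 2 * R + 2 * δ ^ 2 * ∑ x ∈ S, diagSum w x ^ 2 := by
    rw [hR, Finset.mul_sum, Finset.mul_sum, Finset.mul_sum, ← Finset.sum_add_distrib]
    refine Finset.sum_le_sum fun x _ => ?_
    have key : (D x * w x) ^ 2 ≤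
        2 * (D x * w x + δ * diagSum w x) ^ 2 + 2 * δ ^ 2 * diagSum w x ^ 2 := by
      nlinarith [sq_nonneg (D x * w x + 2 * (δ * diagSum w x))]
    by_cases h : 16 ≤ D x ^ 2
    · simp only [hq, h, if_true]
      nlinarith [mul_le_mul_of_nonneg_right h (sq_nonneg (w x))]
    · simp only [hq, h, if_false]
      nlinarith [sq_nonneg (D x * w x)]
  have near : V ≤ ∑ x ∈ S, q x ^ 2 + 2 * R + 2 * δ ^ 2 * ∑ x ∈ S, diagSum q x ^ 2 := by
    rw [hR, hV, Finset.mul_sum, Finset.mul_sum, ← Finset.sum_add_distrib, ← Finset.sum_add_distrib]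
    refine Finset.sum_le_sum fun x hx => ?_
    by_cases h : 16 ≤ D x ^ 2
    · have : q x = w x := by simp [hq, h]
      rw [this]
      have : 0 ≤ 2 * δ ^ 2 * diagSum q x ^ 2 := by positivity
      nlinarith [sq_nonneg (D x * w x + δ * diagSum w x)]
    · have hshift : ∀ d ∈ ({(1, 1), (1, -1), (-1, 1), (-1, -1)} : Finset (ℤ × ℤ)),
          w (x + d) = q (x + d) := fun d hd => by
        by_cases hxd : x + d ∈ S
        · simp [hq, hsep x hx (not_le.mp h) d hd hxd]
        · simp [hq, hw _ hxd]
      have hdiag : diagSum w x = diagSum q x := by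
        simp only [diagSum]
        rw [hshift (1, 1) (by simp), hshift (1, -1) (by simp), hshift (-1, 1) (by simp),
          hshift (-1, -1) (by simp)]
      have hone : w x ^ 2 ≤ (D x * w x) ^ 2 := by
        by_cases hwx : w x = 0
        · simp [hwx]
        · rw [mul_pow]
          exact le_mul_of_one_le_left (sq_nonneg _) (hD x hx hwx)
      rw [hdiag]
      nlinarith [sq_nonneg (D x * w x + 2 * (δ * diagSum q x)), sq_nonneg (q x)]
  have hδA := mul_le_mul_of_nonneg_left hA (sq_nonneg δ)
  have hδq := mul_le_mul_of_nonneg_left hAq (sq_nonneg δ)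
  have hδV := mul_le_mul_of_nonneg_right hδ hpos.le
  have hδQ := mul_le_mul_of_nonneg_right hδ
    (Finset.sum_nonneg fun x (_ : x ∈ S) => sq_nonneg (q x))
  have hstrict : δ ^ 2 * V < 1 / 16 * V :=
    mul_lt_mul_of_pos_right (by nlinarith) hpos
  linarith

/-- The centre is the only resonant site of an admissible square. -/
theorem eq_center_of_resonant {j n L p q : ℤ} (hn : n + j ^ 2 = 0) (hj : 20 < |j|)
    (hL : L ≤ 2 * (|j| - 1)) (hp : |p - j| ≤ L) (hq : |q - n| ≤ L) (h : q + p ^ 2 = 0) :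
    p = j ∧ q = n := by
  have hpa : |p| = |j| := by
    rw [abs_le] at hq
    have h1 := sq_abs p
    have h2 := sq_abs j
    apply le_antisymm <;> by_contra! hlt <;> nlinarith [abs_nonneg p]
  have hpj : p = j := by
    rcases abs_eq_abs.mp hpa with h | h
    · exact h
    · rcases abs_cases j with ⟨hj1, _⟩ | ⟨hj1, _⟩ <;> rw [abs_le] at hp <;> omega
  subst hpj
  exact ⟨rfl, by linarith⟩

/-- Two diagonal neighbours in an admissible square cannot both be nearly resonant. -/
theorem nearly_resonant_separated {j n L p q a b : ℤ} (hn : n + j ^ 2 = 0) (hj : 20 < |j|)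
    (hL : L ≤ 2 * (|j| - 1)) (hq : |q - n| ≤ L) (ha : a = 1 ∨ a = -1) (hb : b = 1 ∨ b = -1)
    (h : (q + p ^ 2) ^ 2 < 16) : 16 ≤ (q + b + (p + a) ^ 2) ^ 2 := by
  have habs : |q + p ^ 2| < 4 := abs_lt_of_sq_lt_sq (by linarith) (by norm_num)
  rw [abs_lt] at habs
  rw [abs_le] at hq
  have hp : 10 ≤ |p| := by
    by_contra! hlt
    nlinarith [sq_abs p, sq_abs j, abs_nonneg p]
  have hbig : 4 ≤ |q + b + (p + a) ^ 2| := by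
    rw [le_abs] at hp ⊢
    rcases ha with rfl | rfl <;> rcases hb with rfl | rfl <;> rcases hp with hp | hp <;>
      ring_nf at * <;> omega
  nlinarith [sq_abs (q + b + (p + a) ^ 2)]

theorem mem_sqΛ {j n L : ℤ} {x : ℤ × ℤ} : x ∈ sqΛ j n L ↔ |x.1 - j| ≤ L ∧ |x.2 - n| ≤ L := by
  simp only [sqΛ, Finset.mem_product, Finset.mem_Icc, abs_le]
  constructor <;> intro h <;> omega

/-- for small `δ`, the matrix `H_{Λ_j}` has exactly one eigenvalue
(counted with multiplicity) in `[−2δ, 2δ]`, for `|j| > j₀` and any admissible `L`. -/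
theorem unique_eigenvalue_in_window (δ : ℝ) (hδ0 : 0 < δ) (hδ1 : δ < 1 / 4) :
    ∃ j₀ : ℤ, 0 < j₀ ∧
      ∀ j n L : ℤ, n + j ^ 2 = 0 → j₀ < |j| → |j| ≤ L → L ≤ 2 * (|j| - 1) →
        ∀ hH : (Hmat δ (sqΛ j n L)).IsHermitian,
          ∃! i : (sqΛ j n L), hH.eigenvalues i ∈ Set.Icc (-(2 * δ)) (2 * δ) := by
  refine ⟨20, by norm_num, fun j n L hn hj hjL hL hH => ?_⟩
  set S := sqΛ j n L with hS
  have hc : (j, n) ∈ S := mem_sqΛ.mpr (by simp; omega)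
  have window (μ : ℝ) : μ ∈ Set.Icc (-(2 * δ)) (2 * δ) ↔ μ ^ 2 ≤ (2 * δ) ^ 2 := by
    rw [Set.mem_Icc, ← abs_le, sq_le_sq, abs_of_pos (by linarith : 0 < 2 * δ)]
  simp only [window]
  refine existsUnique_of_exists_of_unique ?_ fun i k hi hk => by_contra fun hik => ?_
  · set w : ℤ × ℤ → ℝ := fun x => if x = (j, n) then 1 else 0 with hw
    have hwS : ∀ x ∉ S, w x = 0 := fun x hx => if_neg fun h : x = (j, n) => hx (h ▸ hc)
    have hsum : ∑ x : S, w x ^ 2 = ∑ x ∈ S, w x ^ 2 := Finset.sum_coe_sort S fun x => w x ^ 2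
    refine exists_eigenvalue_sq_le hH (v := fun x => w x)
      (fun h => by simpa [hw] using congrFun h ⟨(j, n), hc⟩) ?_
    simp only [Hmat_mulVec δ S hwS]
    rw [Finset.sum_coe_sort S fun x =>
      (((x.2 + x.1 ^ 2 : ℤ) : ℝ) * w x + δ * diagSum w x) ^ 2, hsum]
    have hterm (x : ℤ × ℤ) : (((x.2 + x.1 ^ 2 : ℤ) : ℝ) * w x + δ * diagSum w x) ^ 2 =
        δ ^ 2 * diagSum (fun y => w y ^ 2) x := by
      have hzero : ((x.2 + x.1 ^ 2 : ℤ) : ℝ) * w x = 0 := by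
        by_cases hx : x = (j, n)
        · simp only [hx, hn, Int.cast_zero, zero_mul]
        · simp [hw, hx]
      rw [hzero, zero_add, mul_pow]
      congr 1
      obtain ⟨p, q⟩ := x
      simp only [diagSum, hw, Prod.mk_add_mk, Prod.mk.injEq]
      split_ifs <;> first | omega | norm_num
    simp only [hterm, ← Finset.mul_sum]
    have := sum_diagSum_le S S (f := fun y => w y ^ 2) (fun _ => sq_nonneg _)
      (fun x hx => by simp [hwS x hx])
    nlinarith [mul_le_mul_of_nonneg_left this (sq_nonneg δ)]
  · obtain ⟨v, hv0, hvpos, hvle⟩ :=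
      exists_vanishing_of_two_eigenvalues hH hik hi hk ⟨(j, n), hc⟩
    set w : ℤ × ℤ → ℝ := fun x => if h : x ∈ S then v ⟨x, h⟩ else 0 with hw
    have hwS : ∀ x ∉ S, w x = 0 := fun x hx => dif_neg hx
    have hvw : v = fun x : S => w x := by ext x; simp [hw]
    have hwc : w (j, n) = 0 := by simpa [hw, hc] using hv0
    rw [hvw, Finset.sum_coe_sort S fun x => w x ^ 2] at hvpos hvle
    simp only [Hmat_mulVec δ S hwS] at hvle
    rw [Finset.sum_coe_sort S fun x =>
      (((x.2 + x.1 ^ 2 : ℤ) : ℝ) * w x + δ * diagSum w x) ^ 2] at hvle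
    refine absurd hvle (not_le.mpr (sum_sq_lower_bound hδ0 hδ1 S
      (D := fun x => ((x.2 + x.1 ^ 2 : ℤ) : ℝ)) hwS hvpos ?_ ?_))
    · rintro ⟨p, q⟩ hx hne
      obtain ⟨hp, hq⟩ := mem_sqΛ.mp hx
      have hD : q + p ^ 2 ≠ 0 := fun h => by
        obtain ⟨rfl, rfl⟩ := eq_center_of_resonant hn hj hL hp hq h
        exact hne hwc
      have : 1 ≤ (q + p ^ 2) ^ 2 := Int.add_one_le_iff.mpr (by positivity : 0 < (q + p ^ 2) ^ 2)
      exact_mod_cast this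
    · rintro ⟨p, q⟩ hx hsmall ⟨a, b⟩ hd -
      have hab : (a = 1 ∨ a = -1) ∧ (b = 1 ∨ b = -1) := by
        simp only [Finset.mem_insert, Finset.mem_singleton, Prod.mk.injEq] at hd
        omega
      have := nearly_resonant_separated hn hj hL (mem_sqΛ.mp hx).2 hab.1 hab.2
        (by exact_mod_cast hsmall)
      exact_mod_cast this
end
end
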